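/- Let U, V, W > 0 with W ≠ 3 satisfy (i) −4U² − 4V² + 4UV(W + W⁻¹) − (W − W⁻¹)² > 0 and (ii) −4U² − 4V² + 4UV(W − 3W⁻¹) − (W − W⁻¹)(W − 9W⁻¹) ≥ 0. Then, with ζ_c* = −4U² − 4V² + 4UV(W + W⁻¹) − (W⁻¹ − W)(3W⁻¹ − W) and λ_c* = 4UV − 4V²W⁻¹ + (W⁻¹ − W), one has 4ζ_c*·W⁻¹·(UW − V)(UW − 3V) + 8λ_c*(V² − U²) > 0. -/

import Mathlib

theorem stmt7 (U V W : ℝ) (hU : 0 < U) (hV : 0 < V) (hW : 0 < W) (hW3 : W ≠ 3)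
    (h1 : 0 < -4 * U ^ 2 - 4 * V ^ 2 + 4 * U * V * (W + W⁻¹) - (W - W⁻¹) ^ 2)
    (h2 : 0 ≤ -4 * U ^ 2 - 4 * V ^ 2 + 4 * U * V * (W - 3 * W⁻¹)
            - (W - W⁻¹) * (W - 9 * W⁻¹)) :
    0 < 4 * (-4 * U ^ 2 - 4 * V ^ 2 + 4 * U * V * (W + W⁻¹) - (W⁻¹ - W) * (3 * W⁻¹ - W))
          * W⁻¹ * (U * W - V) * (U * W - 3 * V)
        + 8 * (4 * U * V - 4 * V ^ 2 * W⁻¹ + (W⁻¹ - W)) * (V ^ 2 - U ^ 2) := by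
  have key : 4 * (-4 * U ^ 2 - 4 * V ^ 2 + 4 * U * V * (W + W⁻¹) - (W⁻¹ - W) * (3 * W⁻¹ - W))
          * W⁻¹ * (U * W - V) * (U * W - 3 * V)
        + 8 * (4 * U * V - 4 * V ^ 2 * W⁻¹ + (W⁻¹ - W)) * (V ^ 2 - U ^ 2)
      = 2 * W⁻¹ * ((U * W - V) ^ 2 * (-4 * U ^ 2 - 4 * V ^ 2 + 4 * U * V * (W - 3 * W⁻¹)
            - (W - W⁻¹) * (W - 9 * W⁻¹))
        + (U * W - 3 * V) ^ 2 *
          (-4 * U ^ 2 - 4 * V ^ 2 + 4 * U * V * (W + W⁻¹) - (W - W⁻¹) ^ 2)) := by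
    field_simp
    ring
  rw [key]
  refine mul_pos (by positivity) ?_
  by_cases h : U * W - 3 * V = 0
  · have hx : U * W - V = 2 * V := by linarith
    have hUe : V = U * W / 3 := by linarith
    have e2 : -4 * U ^ 2 - 4 * V ^ 2 + 4 * U * V * (W - 3 * W⁻¹)
            - (W - W⁻¹) * (W - 9 * W⁻¹) = (W ^ 2 - 9) * (8 * V ^ 2 - W ^ 2 + 1) * (W⁻¹) ^ 2 := by
      rw [hUe]; field_simp; ring
    have e1 : -4 * U ^ 2 - 4 * V ^ 2 + 4 * U * V * (W + W⁻¹) - (W - W⁻¹) ^ 2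
        = (8 * V ^ 2 * (W ^ 2 - 3) - (W ^ 2 - 1) ^ 2) * (W⁻¹) ^ 2 := by
      rw [hUe]; field_simp; ring
    have n1 : W ^ 2 - 9 ≠ 0 := by
      intro h0
      have h9 : (W - 3) * (W + 3) = 0 := by linarith
      rcases mul_eq_zero.mp h9 with h | h
      · exact hW3 (by linarith)
      · linarith
    have n2 : 8 * V ^ 2 - W ^ 2 + 1 ≠ 0 := by
      intro h0
      have hs : W ^ 2 = 8 * V ^ 2 + 1 := by linarith
      rw [e1] at h1
      have h3 := pos_of_mul_pos_left h1 (by positivity)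
      rw [hs] at h3
      nlinarith [pow_pos hV 2]
    have n3 : 0 < -4 * U ^ 2 - 4 * V ^ 2 + 4 * U * V * (W - 3 * W⁻¹)
            - (W - W⁻¹) * (W - 9 * W⁻¹) := by
      refine lt_of_le_of_ne h2 (Ne.symm ?_)
      rw [e2]
      exact mul_ne_zero (mul_ne_zero n1 n2) (by positivity)
    rw [h, hx]
    have := mul_pos (show 0 < (2 * V) ^ 2 by positivity) n3
    linarith
  · have hp : 0 < (U * W - 3 * V) ^ 2 := by positivity
    have a := mul_pos hp h1
    have b := mul_nonneg (sq_nonneg (U * W - V)) h2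
    linarith
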